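/- arXiv:1512.02644 — 2 statements merged into one kernel-verified Lean document; each statement's English description precedes it below -/
import Mathlib

section
/- Let n ≥ 1, let f : ℝⁿ → ℝ be continuous with compact support, and let χ : ℝⁿ → ℝ be infinitely differentiable with fderiv χ x ≠ 0 for every x in the (closed) support of f. Then, as the real parameter ω tends to +∞, the integral ∫_{ℝⁿ} f(x) (sin(ω χ(x)))² dx converges to (1/2) ∫_{ℝⁿ} f(x) dx. -/
open MeasureTheory Filter

/-- A compactly supported `C¹` function whose support contains no critical point of `χ` is the
derivative of `χ` along a compactly supported `C¹` vector field. -/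
lemma exists_vectorField_sum_mul_fderiv_eq {ι : Type*} [Fintype ι] [DecidableEq ι]
    {g χ : (ι → ℝ) → ℝ} (hg : ContDiff ℝ 1 g) (hsupp : HasCompactSupport g)
    (hχ : ContDiff ℝ 2 χ) (hcrit : ∀ x ∈ tsupport g, fderiv ℝ χ x ≠ 0) :
    ∃ h : ι → (ι → ℝ) → ℝ, (∀ i, ContDiff ℝ 1 (h i)) ∧ (∀ i, HasCompactSupport (h i)) ∧
      ∀ x, g x = ∑ i, h i x * fderiv ℝ χ x (Pi.single i 1) := by
  set d : ι → (ι → ℝ) → ℝ := fun i x => fderiv ℝ χ x (Pi.single i 1) with hd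
  have hdc (i : ι) : ContDiff ℝ 1 (d i) :=
    (hχ.fderiv_right (m := 1) (by norm_num)).clm_apply contDiff_const
  have hN : ∀ x ∈ tsupport g, ∑ j, d j x ^ 2 ≠ 0 := by
    intro x hx h0
    refine hcrit x hx ?_
    rw [Finset.sum_eq_zero_iff_of_nonneg fun j _ => sq_nonneg _] at h0
    refine ContinuousLinearMap.coe_injective (LinearMap.pi_ext' fun i => LinearMap.ext_ring ?_)
    simpa [hd] using h0 i (Finset.mem_univ i)
  refine ⟨fun i x => g x * (d i x / ∑ j, d j x ^ 2), fun i => ?_, fun i => hsupp.mul_right,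
    fun x => ?_⟩
  · rw [contDiff_iff_contDiffAt]
    intro x
    by_cases hx : x ∈ tsupport g
    · exact hg.contDiffAt.mul ((hdc i).contDiffAt.div
        (ContDiff.sum fun j _ => (hdc j).pow 2).contDiffAt (hN x hx))
    · refine (contDiffAt_const (c := (0 : ℝ))).congr_of_eventuallyEq ?_
      filter_upwards [notMem_tsupport_iff_eventuallyEq.mp hx] with y hy
      simp [hy]
  · by_cases hx : x ∈ tsupport g
    · have h1 : ∑ i, g x * (d i x / ∑ j, d j x ^ 2) * d i x
          = g x * ((∑ i, d i x ^ 2) / ∑ j, d j x ^ 2) := by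
        rw [Finset.sum_div, Finset.mul_sum]
        exact Finset.sum_congr rfl fun i _ => by ring
      rw [h1, div_self (hN x hx), mul_one]
    · simp [image_eq_zero_of_notMem_tsupport hx]

/-- Nonstationary phase: the oscillatory integral is `O(1 / t)`. -/
lemma exists_abs_mul_integral_mul_cos_le {ι : Type*} [Fintype ι]
    {g χ : (ι → ℝ) → ℝ} (hg : ContDiff ℝ 1 g) (hsupp : HasCompactSupport g)
    (hχ : ContDiff ℝ 2 χ) (hcrit : ∀ x ∈ tsupport g, fderiv ℝ χ x ≠ 0) :
    ∃ C : ℝ, ∀ t : ℝ, |t * ∫ x, g x * Real.cos (t * χ x)| ≤ C := by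
  classical
  obtain ⟨h, hh, hhs, hsum⟩ := exists_vectorField_sum_mul_fderiv_eq hg hsupp hχ hcrit
  refine ⟨∑ i, ∫ x, |fderiv ℝ (h i) x (Pi.single i 1)|, fun t => ?_⟩
  have hχd : Differentiable ℝ χ := hχ.differentiable (by norm_num)
  have hS (x v : ι → ℝ) : fderiv ℝ (fun y => Real.sin (t * χ y)) x v
      = t * (fderiv ℝ χ x v * Real.cos (t * χ x)) := by
    rw [(((hχd x).hasFDerivAt.const_mul t).sin).fderiv]
    simp
    ring
  have hSd : Differentiable ℝ (fun y => Real.sin (t * χ y)) := (hχd.const_mul t).sin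
  have hcos : Continuous fun x => Real.cos (t * χ x) :=
    Real.continuous_cos.comp (hχ.continuous.const_mul t)
  have hcd (i : ι) : Continuous fun x => fderiv ℝ χ x (Pi.single i 1) :=
    (hχ.continuous_fderiv (by norm_num)).clm_apply continuous_const
  have hch (i : ι) : Continuous fun x => fderiv ℝ (h i) x (Pi.single i 1) :=
    ((hh i).continuous_fderiv (by norm_num)).clm_apply continuous_const
  have hsh (i : ι) : HasCompactSupport fun x => fderiv ℝ (h i) x (Pi.single i 1) :=
    (hhs i).fderiv_apply ℝ _
  have hint (i : ι) : Integrable fun x =>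
      h i x * fderiv ℝ (fun y => Real.sin (t * χ y)) x (Pi.single i 1) := by
    simp only [hS]
    exact ((hh i).continuous.mul (((hcd i).mul hcos).const_mul t)).integrable_of_hasCompactSupport
      (hhs i).mul_right
  have hparts (i : ι) : ∫ x, h i x * fderiv ℝ (fun y => Real.sin (t * χ y)) x (Pi.single i 1)
      = - ∫ x, fderiv ℝ (h i) x (Pi.single i 1) * Real.sin (t * χ x) :=
    integral_mul_fderiv_eq_neg_fderiv_mul_of_integrable
      (((hch i).mul hSd.continuous).integrable_of_hasCompactSupport (hsh i).mul_right)
      (hint i)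
      (((hh i).continuous.mul hSd.continuous).integrable_of_hasCompactSupport (hhs i).mul_right)
      (fun x _ => (hh i).differentiable (by norm_num) x) (fun x _ => hSd x)
  have heq : t * ∫ x, g x * Real.cos (t * χ x)
      = ∑ i, ∫ x, h i x * fderiv ℝ (fun y => Real.sin (t * χ y)) x (Pi.single i 1) := by
    rw [← integral_const_mul, ← integral_finsetSum _ fun i _ => hint i]
    refine integral_congr_ae (.of_forall fun x => ?_)
    simp only [hS]
    rw [hsum x, Finset.sum_mul, Finset.mul_sum]
    exact Finset.sum_congr rfl fun i _ => by ring
  rw [heq]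
  refine (Finset.abs_sum_le_sum_abs _ _).trans (Finset.sum_le_sum fun i _ => ?_)
  rw [hparts, abs_neg, ← Real.norm_eq_abs]
  refine norm_integral_le_of_norm_le
    ((hch i).integrable_of_hasCompactSupport (hsh i)).abs (.of_forall fun x => ?_)
  rw [Real.norm_eq_abs, abs_mul]
  exact mul_le_of_le_one_right (abs_nonneg _) (Real.abs_sin_le_one _)

/-- Riemann–Lebesgue lemma for a phase without critical points on the support of the density. -/
lemma tendsto_integral_mul_cos_phase {ι : Type*} [Fintype ι]
    {f χ : (ι → ℝ) → ℝ} (hf : Continuous f) (hsupp : HasCompactSupport f)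
    (hχ : ContDiff ℝ 2 χ) (hcrit : ∀ x ∈ tsupport f, fderiv ℝ χ x ≠ 0) :
    Tendsto (fun t : ℝ => ∫ x, f x * Real.cos (t * χ x)) atTop (nhds 0) := by
  rw [Metric.tendsto_nhds]
  intro ε hε
  set V : ℝ := volume.real (tsupport f)
  have hVfin : volume (tsupport f) < ⊤ := hsupp.isCompact.measure_lt_top
  have hV : 0 ≤ V := measureReal_nonneg
  set δ : ℝ := ε / (2 * (V + 1))
  have hδ : 0 < δ := by positivity
  have hδV : δ * V < ε / 2 := by
    have : δ * (V + 1) = ε / 2 := by simp only [δ]; field_simp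
    nlinarith
  obtain ⟨g, hg, hgf, hgs⟩ := hf.exists_contDiff_approx 1 (ε := fun _ => δ) continuous_const
    fun _ => hδ
  have hts : tsupport g ⊆ tsupport f := closure_mono hgs
  have hgc : HasCompactSupport g := hsupp.mono hgs
  obtain ⟨C, hC⟩ := exists_abs_mul_integral_mul_cos_le hg hgc hχ fun x hx => hcrit x (hts hx)
  filter_upwards [eventually_gt_atTop 0, eventually_gt_atTop (2 * C / ε)] with t ht htC
  have hcos : Continuous fun x => Real.cos (t * χ x) :=
    Real.continuous_cos.comp (hχ.continuous.const_mul t)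
  have hfi : Integrable fun x => f x * Real.cos (t * χ x) :=
    (hf.mul hcos).integrable_of_hasCompactSupport hsupp.mul_right
  have hgi : Integrable fun x => g x * Real.cos (t * χ x) :=
    (hg.continuous.mul hcos).integrable_of_hasCompactSupport hgc.mul_right
  have hmain : |∫ x, g x * Real.cos (t * χ x)| < ε / 2 := by
    have h1 := hC t
    rw [abs_mul, abs_of_pos ht] at h1
    rw [div_lt_iff₀ hε] at htC
    by_contra! h2
    nlinarith [mul_le_mul_of_nonneg_left h2 ht.le]
  have herr : |(∫ x, f x * Real.cos (t * χ x)) - ∫ x, g x * Real.cos (t * χ x)| ≤ δ * V := by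
    rw [← integral_sub hfi hgi, ← setIntegral_eq_integral_of_forall_compl_eq_zero
      (s := tsupport f) fun x hx => by
        simp [image_eq_zero_of_notMem_tsupport hx,
          image_eq_zero_of_notMem_tsupport fun h => hx (hts h)],
      ← Real.norm_eq_abs]
    refine norm_setIntegral_le_of_norm_le_const hVfin fun x _ => ?_
    rw [← sub_mul, Real.norm_eq_abs, abs_mul, abs_sub_comm]
    exact (mul_le_of_le_one_right (abs_nonneg _) (Real.abs_cos_le_one _)).trans (hgf x).le
  rw [Real.dist_eq, sub_zero]
  have := abs_sub_abs_le_abs_sub (∫ x, f x * Real.cos (t * χ x)) (∫ x, g x * Real.cos (t * χ x))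
  linarith

/-- Weak limit sin²(ωχ) → 1/2: against a continuous compactly supported density f whose
support contains no critical point of the smooth phase χ, the integral of f·sin²(ωχ)
tends to (1/2)∫f as ω → +∞. -/
theorem sin_sq_weak_limit (n : ℕ) (hn : 1 ≤ n)
    (f : (Fin n → ℝ) → ℝ) (hf : Continuous f) (hsupp : HasCompactSupport f)
    (χ : (Fin n → ℝ) → ℝ) (hχ : ContDiff ℝ (⊤ : ℕ∞) χ)
    (hcrit : ∀ x ∈ tsupport f, fderiv ℝ χ x ≠ 0) :
    Tendsto (fun ω : ℝ => ∫ x, f x * (Real.sin (ω * χ x)) ^ 2) atTop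
      (nhds ((1 / 2) * ∫ x, f x)) := by
  have hlim := (tendsto_integral_mul_cos_phase hf hsupp (contDiff_infty.mp hχ 2)
    hcrit).comp (tendsto_id.const_mul_atTop (zero_lt_two' ℝ))
  have hlim' := (hlim.const_mul (1 / 2)).const_sub ((1 / 2) * ∫ x, f x)
  rw [mul_zero, sub_zero] at hlim'
  refine hlim'.congr fun ω => ?_
  have hfi : Integrable f := hf.integrable_of_hasCompactSupport hsupp
  have hci : Integrable fun x => f x * Real.cos (2 * ω * χ x) :=
    (hf.mul (Real.continuous_cos.comp
      (hχ.continuous.const_mul _))).integrable_of_hasCompactSupport hsupp.mul_right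
  simp only [Function.comp_apply, id]
  rw [← mul_sub, ← integral_sub hfi hci, ← integral_const_mul]
  refine integral_congr_ae (.of_forall fun x => ?_)
  simp only [Real.sin_sq_eq_half_sub, mul_assoc]
  ring
end

section
/- Let n ≥ 1, let A : ℝⁿ → ℂ be infinitely differentiable with compact support, and let χ : ℝⁿ → ℝ be infinitely differentiable with fderiv χ x ≠ 0 for every x in the (closed) support of A. Then for every natural number k there is a constant C > 0 such that for all real ω ≥ 1, |∫_{ℝⁿ} A(x) exp(i ω χ(x)) dx| ≤ C ω^{−k}. -/
open MeasureTheory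

section NonstationaryPhase

variable {E : Type*} [NormedAddCommGroup E] [NormedSpace ℝ E]

theorem hasFDerivAt_exp_I_mul_phase {χ : E → ℝ} {x : E} (hχ : DifferentiableAt ℝ χ x) (ω : ℝ) :
    HasFDerivAt (fun y => Complex.exp (Complex.I * ((ω * χ y : ℝ) : ℂ)))
      (Complex.exp (Complex.I * ((ω * χ x : ℝ) : ℂ)) •
        (Complex.I • Complex.ofRealCLM.comp (ω • fderiv ℝ χ x))) x :=
  ((Complex.ofRealCLM.hasFDerivAt.comp x (hχ.hasFDerivAt.const_mul ω)).const_mul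
    Complex.I).cexp

theorem contDiff_exp_I_mul_phase {χ : E → ℝ} {m : WithTop ℕ∞} (hχ : ContDiff ℝ m χ) (ω : ℝ) :
    ContDiff ℝ m (fun y => Complex.exp (Complex.I * ((ω * χ y : ℝ) : ℂ))) :=
  (contDiff_const.mul (Complex.ofRealCLM.contDiff.comp (contDiff_const.mul hχ))).cexp

theorem norm_exp_I_mul_ofReal_eq_one (t : ℝ) :
    ‖Complex.exp (Complex.I * (t : ℂ))‖ = 1 := by
  rw [mul_comm, Complex.norm_exp_ofReal_mul_I]

variable [FiniteDimensional ℝ E] [MeasurableSpace E] [BorelSpace E]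
  {μ : Measure E} [μ.IsAddHaarMeasure]

/-- Integration by parts in one direction against an oscillating exponential. -/
theorem integral_phase_deriv_mul_exp {a : E → ℂ} {χ : E → ℝ}
    (ha : ContDiff ℝ (⊤ : ℕ∞) a) (hsupp : HasCompactSupport a)
    (hχ : ContDiff ℝ (⊤ : ℕ∞) χ) (v : E) (ω : ℝ) :
    ∫ x, a x * (Complex.exp (Complex.I * ((ω * χ x : ℝ) : ℂ)) *
        (Complex.I * ((ω * fderiv ℝ χ x v : ℝ) : ℂ))) ∂μ =
      -∫ x, fderiv ℝ a x v * Complex.exp (Complex.I * ((ω * χ x : ℝ) : ℂ)) ∂μ := by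
  have hχd : Differentiable ℝ χ := hχ.differentiable (by simp)
  have he := contDiff_exp_I_mul_phase hχ ω
  have hfd (x : E) : fderiv ℝ (fun y => Complex.exp (Complex.I * ((ω * χ y : ℝ) : ℂ))) x v =
      Complex.exp (Complex.I * ((ω * χ x : ℝ) : ℂ)) *
        (Complex.I * ((ω * fderiv ℝ χ x v : ℝ) : ℂ)) := by
    rw [(hasFDerivAt_exp_I_mul_phase (hχd x) ω).fderiv]
    simp
  simp_rw [← hfd]
  have hac := ha.continuous
  have hec := he.continuous
  have hadc : Continuous fun x => fderiv ℝ a x v :=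
    (ha.continuous_fderiv (by simp)).clm_apply continuous_const
  have hedc : Continuous fun x =>
      fderiv ℝ (fun y => Complex.exp (Complex.I * ((ω * χ y : ℝ) : ℂ))) x v :=
    (he.continuous_fderiv (by simp)).clm_apply continuous_const
  apply integral_mul_fderiv_eq_neg_fderiv_mul_of_integrable
  · exact (hadc.mul hec).integrable_of_hasCompactSupport (hsupp.fderiv_apply ℝ v).mul_right
  · exact (hac.mul hedc).integrable_of_hasCompactSupport hsupp.mul_right
  · exact (hac.mul hec).integrable_of_hasCompactSupport hsupp.mul_right
  · exact fun x _ => ha.differentiable (by simp) x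
  · exact fun x _ => he.differentiable (by simp) x

/-- The amplitude transport step: one power of the frequency is traded for a new amplitude. -/
theorem exists_amplitude_integral_exp_eq {A : E → ℂ} {χ : E → ℝ}
    (hA : ContDiff ℝ (⊤ : ℕ∞) A) (hsupp : HasCompactSupport A)
    (hχ : ContDiff ℝ (⊤ : ℕ∞) χ) (hcrit : ∀ x ∈ tsupport A, fderiv ℝ χ x ≠ 0) :
    ∃ B : E → ℂ, ContDiff ℝ (⊤ : ℕ∞) B ∧ HasCompactSupport B ∧ tsupport B ⊆ tsupport A ∧
      ∀ ω : ℝ, Complex.I * (ω : ℂ) *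
          ∫ x, A x * Complex.exp (Complex.I * ((ω * χ x : ℝ) : ℂ)) ∂μ =
        ∫ x, B x * Complex.exp (Complex.I * ((ω * χ x : ℝ) : ℂ)) ∂μ := by
  let b := Module.finBasis ℝ E
  let q : E → ℝ := fun x => ∑ j, fderiv ℝ χ x (b j) ^ 2
  have hχ' (v : E) : ContDiff ℝ (⊤ : ℕ∞) fun x => fderiv ℝ χ x v :=
    (hχ.fderiv_right (by simp)).clm_apply contDiff_const
  have hq : ContDiff ℝ (⊤ : ℕ∞) q := ContDiff.sum fun j _ => (hχ' (b j)).pow 2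
  have hq0 : ∀ x ∈ tsupport A, q x ≠ 0 := by
    intro x hx hqx
    refine hcrit x hx (ContinuousLinearMap.coe_injective (b.ext fun j => ?_))
    have := (Finset.sum_eq_zero_iff_of_nonneg fun i _ => sq_nonneg _).1 hqx j (Finset.mem_univ j)
    simpa using this
  let a : Fin (Module.finrank ℝ E) → E → ℂ :=
    fun j x => A x * ((fderiv ℝ χ x (b j) / q x : ℝ) : ℂ)
  have hasub (j) : tsupport (a j) ⊆ tsupport A := tsupport_mul_subset_left
  have hac (j) : HasCompactSupport (a j) := hsupp.mul_right
  have ha (j) : ContDiff ℝ (⊤ : ℕ∞) (a j) := (contMDiff_of_tsupport fun x hx =>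
    (hA.contDiffAt.mul (Complex.ofRealCLM.contDiff.contDiffAt.comp x
      ((hχ' (b j)).contDiffAt.div hq.contDiffAt (hq0 x (hasub j hx))))).contMDiffAt).contDiff
  have ha' (j) : ContDiff ℝ (⊤ : ℕ∞) fun x => fderiv ℝ (a j) x (b j) :=
    ((ha j).fderiv_right (by simp)).clm_apply contDiff_const
  have hBsub : tsupport (fun x => -∑ j, fderiv ℝ (a j) x (b j)) ⊆ tsupport A := by
    refine closure_minimal (fun x hx => ?_) (isClosed_tsupport A)
    by_contra hxA
    refine hx ?_
    have hzero (j : Fin _) : fderiv ℝ (a j) x = 0 :=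
      fderiv_of_notMem_tsupport (𝕜 := ℝ) fun h => hxA (hasub j h)
    simp [hzero]
  refine ⟨fun x => -∑ j, fderiv ℝ (a j) x (b j), (ContDiff.sum fun j _ => ha' j).neg,
    hsupp.of_isClosed_subset (isClosed_tsupport _) hBsub, hBsub, fun ω => ?_⟩
  have hec := (contDiff_exp_I_mul_phase hχ ω).continuous
  have hsum (x : E) : Complex.I * (ω : ℂ) *
      (A x * Complex.exp (Complex.I * ((ω * χ x : ℝ) : ℂ))) =
      ∑ j, a j x * (Complex.exp (Complex.I * ((ω * χ x : ℝ) : ℂ)) *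
        (Complex.I * ((ω * fderiv ℝ χ x (b j) : ℝ) : ℂ))) := by
    by_cases hx : x ∈ tsupport A
    · have hone : ∑ j, ((fderiv ℝ χ x (b j) / q x * fderiv ℝ χ x (b j) : ℝ) : ℂ) = 1 := by
        rw [← Complex.ofReal_sum, ← Complex.ofReal_one]
        congr 1
        rw [← div_self (hq0 x hx), Finset.sum_div]
        exact Finset.sum_congr rfl fun j _ => by ring
      rw [← mul_one (Complex.I * _ * _), ← hone, Finset.mul_sum]
      refine Finset.sum_congr rfl fun j _ => ?_
      simp only [a]
      push_cast
      ring
    · simp [a, image_eq_zero_of_notMem_tsupport hx]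
  rw [← integral_const_mul]
  simp_rw [hsum]
  rw [integral_finsetSum]
  · simp_rw [integral_phase_deriv_mul_exp (ha _) (hac _) hχ, Finset.sum_neg_distrib, neg_mul,
      Finset.sum_mul, integral_neg]
    rw [integral_finsetSum]
    exact fun j _ => ((ha' j).continuous.mul hec).integrable_of_hasCompactSupport
      ((hac j).fderiv_apply ℝ (b j)).mul_right
  · intro j _
    refine ((ha j).continuous.mul (hec.mul (continuous_const.mul
      (Complex.continuous_ofReal.comp (continuous_const.mul
        (hχ' (b j)).continuous))))).integrable_of_hasCompactSupport (hac j).mul_right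

/-- Non-stationary phase on a finite-dimensional space with a Haar measure. -/
theorem exists_norm_integral_exp_le_zpow {χ : E → ℝ} (hχ : ContDiff ℝ (⊤ : ℕ∞) χ) (k : ℕ)
    {A : E → ℂ} (hA : ContDiff ℝ (⊤ : ℕ∞) A) (hsupp : HasCompactSupport A)
    (hcrit : ∀ x ∈ tsupport A, fderiv ℝ χ x ≠ 0) :
    ∃ C > 0, ∀ ω : ℝ, 1 ≤ ω →
      ‖∫ x, A x * Complex.exp (Complex.I * ((ω * χ x : ℝ) : ℂ)) ∂μ‖ ≤ C * ω ^ (-(k : ℤ)) := by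
  induction k generalizing A with
  | zero =>
    refine ⟨(∫ x, ‖A x‖ ∂μ) + 1, by positivity, fun ω _ => ?_⟩
    refine (norm_integral_le_integral_norm _).trans ?_
    simp only [norm_mul, norm_exp_I_mul_ofReal_eq_one]
    simp
  | succ k ih =>
    obtain ⟨B, hB, hBc, hBA, hAB⟩ := exists_amplitude_integral_exp_eq (μ := μ) hA hsupp hχ hcrit
    obtain ⟨C, hC, h⟩ := ih hB hBc fun x hx => hcrit x (hBA hx)
    refine ⟨C, hC, fun ω hω => ?_⟩
    have hω0 : 0 < ω := by linarith
    have hle := h ω hω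
    rw [← hAB ω, norm_mul, norm_mul, Complex.norm_I, one_mul, Complex.norm_real,
      Real.norm_of_nonneg hω0.le] at hle
    have hpow : ω ^ (-((k + 1 : ℕ) : ℤ)) = ω ^ (-(k : ℤ)) / ω := by
      rw [div_eq_mul_inv, ← zpow_sub_one₀ hω0.ne']
      congr 1
      push_cast
      ring
    rw [hpow, ← mul_div_assoc, le_div_iff₀ hω0, mul_comm]
    exact hle

end NonstationaryPhase

/-- Non-stationary phase: an oscillatory integral with smooth compactly supported complex
amplitude A and smooth real phase χ without critical points on the support of A decays
faster than any inverse power of the frequency ω. -/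
theorem nonstationary_phase_decay (n : ℕ) (hn : 1 ≤ n)
    (A : (Fin n → ℝ) → ℂ) (hA : ContDiff ℝ (⊤ : ℕ∞) A) (hsupp : HasCompactSupport A)
    (χ : (Fin n → ℝ) → ℝ) (hχ : ContDiff ℝ (⊤ : ℕ∞) χ)
    (hcrit : ∀ x ∈ tsupport A, fderiv ℝ χ x ≠ 0) (k : ℕ) :
    ∃ C > 0, ∀ ω : ℝ, 1 ≤ ω →
      ‖∫ x, A x * Complex.exp (Complex.I * ((ω * χ x : ℝ) : ℂ))‖ ≤ C * ω ^ (-(k : ℤ)) :=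
  exists_norm_integral_exp_le_zpow hχ k hA hsupp hcrit
end
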